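/- Let α₀ = (13√173 + 39)/82 = [2; 1,1,3,1,1,1,1,3, 1,1,3,1,1,1,1,3, …] (purely periodic from a₁ with period 1,1,3,1,1,1,1,3). Then 𝔨(α₀) = liminf_{n→∞, aₙ ≥ 2} κ⁴ₙ(α₀) = 164/(13√173). -/

import Mathlib

open Filter

/-- The tails `αₙ = [aₙ; aₙ₊₁, …]` of the continued fraction of `α`. -/
noncomputable def cfTail (α : ℝ) : ℕ → ℝ
  | 0 => α
  | n + 1 => (Int.fract (cfTail α n))⁻¹

/-- The partial quotients `aₙ` of the continued fraction of `α`. -/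
noncomputable def cfDigit (α : ℝ) (n : ℕ) : ℤ := ⌊cfTail α n⌋

/-- Value `[a; b, c, …]` of a finite continued fraction given by a list. -/
noncomputable def finCF : List ℤ → ℝ
  | [] => 0
  | a :: l => (a : ℝ) + (finCF l)⁻¹

/-- `α*ₙ = [0; aₙ, aₙ₋₁, …, a₁]`. -/
noncomputable def cfStar (α : ℝ) (n : ℕ) : ℝ :=
  (finCF (((List.range' 1 n).reverse).map (cfDigit α)))⁻¹

/-- Numerators `pₙ` of the convergents of `α`. -/
noncomputable def cfNum (α : ℝ) : ℕ → ℤ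
  | 0 => cfDigit α 0
  | 1 => cfDigit α 1 * cfDigit α 0 + 1
  | n + 2 => cfDigit α (n + 2) * cfNum α (n + 1) + cfNum α n

/-- Denominators `qₙ` of the convergents of `α`. -/
noncomputable def cfDen (α : ℝ) : ℕ → ℤ
  | 0 => 1
  | 1 => cfDigit α 1
  | n + 2 => cfDigit α (n + 2) * cfDen α (n + 1) + cfDen α n

/-- The irrationality measure function `ψ_α^[2]` for "second best" approximations. -/
noncomputable def psi2 (α : ℝ) (t : ℝ) : ℝ :=
  sInf { x : ℝ | ∃ p q : ℤ, 1 ≤ q ∧ (q : ℝ) ≤ t ∧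
    (∀ n : ℕ, (p, q) ≠ (cfNum α n, cfDen α n)) ∧ x = |(q : ℝ) * α - (p : ℝ)| }

/-- The Diophantine constant `𝔨(α) = liminf_{t → ∞} t · ψ_α^[2](t)`. -/
noncomputable def kConst (α : ℝ) : ℝ := liminf (fun t : ℝ => t * psi2 α t) atTop

/-- Two numbers are equivalent if the tails of their continued fraction expansions
coincide: `a_{n+k} = b_{m+k}` for all `k ≥ 1`, for some positive integers `m`, `n`. -/
def CFEquiv (α β : ℝ) : Prop :=
  ∃ n m : ℕ, 0 < n ∧ 0 < m ∧ ∀ k : ℕ, 0 < k → cfDigit α (n + k) = cfDigit β (m + k)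

/-- The spectrum `𝕃₂` of values of `𝔨`. -/
def L2 : Set ℝ := { l : ℝ | ∃ α : ℝ, Irrational α ∧ l = kConst α }

/-- `κ¹ₙ(α) = (1 + α*ₙ₋₁)(αₙ − 1)/(αₙ + α*ₙ₋₁)`. -/
noncomputable def kappa1 (α : ℝ) (n : ℕ) : ℝ :=
  (1 + cfStar α (n - 1)) * (cfTail α n - 1) / (cfTail α n + cfStar α (n - 1))

/-- `κ²ₙ(α) = (1 − α*ₙ)(αₙ₊₁ + 1)/(αₙ₊₁ + α*ₙ)`. -/
noncomputable def kappa2 (α : ℝ) (n : ℕ) : ℝ :=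
  (1 - cfStar α n) * (cfTail α (n + 1) + 1) / (cfTail α (n + 1) + cfStar α n)

/-- `κ⁴ₙ(α) = 4/(αₙ + α*ₙ₋₁)`. -/
noncomputable def kappa4 (α : ℝ) (n : ℕ) : ℝ :=
  4 / (cfTail α n + cfStar α (n - 1))

/-- The number `α₀ = [2; 1, 1, 3, 1, 1, 1, 1, 3, …]`. -/
noncomputable def alpha0 : ℝ := (13 * Real.sqrt 173 + 39) / 82

/-- The indefinite binary quadratic form with root `α₀`. -/
def form0 (p q : ℤ) : ℤ := 41 * p ^ 2 - 39 * p * q - 169 * q ^ 2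

lemma cfTail_succ_eq {α x y : ℝ} {n : ℕ} (a : ℤ) (h : cfTail α n = x) (h₁ : (a : ℝ) ≤ x)
    (h₂ : x < a + 1) (hy : (x - a) * y = 1) : cfTail α (n + 1) = y := by
  have hf : ⌊x⌋ = a := Int.floor_eq_iff.2 ⟨h₁, h₂⟩
  rw [cfTail, h, Int.fract, hf]
  exact inv_eq_of_mul_eq_one_right hy

lemma cfStar_zero (α : ℝ) : cfStar α 0 = 0 := by simp [cfStar, finCF]

lemma cfStar_succ (α : ℝ) (n : ℕ) :
    cfStar α (n + 1) = ((cfDigit α (n + 1) : ℝ) + cfStar α n)⁻¹ := by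
  simp [cfStar, List.range'_1_concat, finCF, add_comm]

lemma cfStar_succ_eq_div (α : ℝ) (h : ∀ n, cfDen α n ≠ 0) (n : ℕ) :
    cfStar α (n + 1) = (cfDen α n : ℝ) / cfDen α (n + 1) := by
  induction n with
  | zero => simp [cfStar_succ, cfStar_zero, cfDen]
  | succ n ih =>
    have h₁ : (cfDen α (n + 1) : ℝ) ≠ 0 := by exact_mod_cast h (n + 1)
    rw [cfStar_succ, ih, cfDen]
    push_cast
    rw [← inv_div]
    field_simp

lemma sqrt_173_bounds : 13.15 < Real.sqrt 173 ∧ Real.sqrt 173 < 13.16 :=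
  ⟨Real.lt_sqrt_of_sq_lt (by norm_num), (Real.sqrt_lt' (by norm_num)).2 (by norm_num)⟩

lemma sq_sqrt_173 : Real.sqrt 173 ^ 2 = 173 := Real.sq_sqrt (by norm_num)

/-- One period of tails, starting from `α₀` or from the tail `α₀ + 1` of `α₀`. -/
lemma cfTail_period {n : ℕ} (a : ℤ) (h : cfTail alpha0 n = alpha0 - 2 + a) :
    cfTail alpha0 (n + 1) = (125 + 13 * Real.sqrt 173) / 166 ∧
    cfTail alpha0 (n + 2) = (41 + 13 * Real.sqrt 173) / 166 ∧
    cfTail alpha0 (n + 3) = (125 + 13 * Real.sqrt 173) / 82 ∧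
    cfTail alpha0 (n + 4) = (121 + 13 * Real.sqrt 173) / 178 ∧
    cfTail alpha0 (n + 5) = (57 + 13 * Real.sqrt 173) / 146 ∧
    cfTail alpha0 (n + 6) = (89 + 13 * Real.sqrt 173) / 146 ∧
    cfTail alpha0 (n + 7) = (57 + 13 * Real.sqrt 173) / 178 ∧
    cfTail alpha0 (n + 8) = alpha0 + 1 := by
  obtain ⟨hl, hu⟩ := sqrt_173_bounds
  have hs := sq_sqrt_173
  unfold alpha0 at h ⊢
  have h1 := cfTail_succ_eq (y := (125 + 13 * Real.sqrt 173) / 166) a h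
    (by linarith) (by linarith) (by linarith)
  have h2 := cfTail_succ_eq (y := (41 + 13 * Real.sqrt 173) / 166) 1 h1
    (by push_cast; linarith) (by push_cast; linarith) (by push_cast; linarith)
  have h3 := cfTail_succ_eq (y := (125 + 13 * Real.sqrt 173) / 82) 1 h2
    (by push_cast; linarith) (by push_cast; linarith) (by push_cast; linarith)
  have h4 := cfTail_succ_eq (y := (121 + 13 * Real.sqrt 173) / 178) 3 h3
    (by push_cast; linarith) (by push_cast; linarith) (by push_cast; linarith)
  have h5 := cfTail_succ_eq (y := (57 + 13 * Real.sqrt 173) / 146) 1 h4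
    (by push_cast; linarith) (by push_cast; linarith) (by push_cast; linarith)
  have h6 := cfTail_succ_eq (y := (89 + 13 * Real.sqrt 173) / 146) 1 h5
    (by push_cast; linarith) (by push_cast; linarith) (by push_cast; linarith)
  have h7 := cfTail_succ_eq (y := (57 + 13 * Real.sqrt 173) / 178) 1 h6
    (by push_cast; linarith) (by push_cast; linarith) (by push_cast; linarith)
  have h8 := cfTail_succ_eq (y := (13 * Real.sqrt 173 + 39) / 82 + 1) 1 h7
    (by push_cast; linarith) (by push_cast; linarith) (by push_cast; linarith)
  exact ⟨h1, h2, h3, h4, h5, h6, h7, h8⟩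

lemma cfTail_alpha0_mul_eight (k : ℕ) : ∃ a : ℤ, cfTail alpha0 (8 * k) = alpha0 - 2 + a := by
  induction k with
  | zero => exact ⟨2, by simp [cfTail]⟩
  | succ k ih =>
    obtain ⟨a, h⟩ := ih
    obtain ⟨-, -, -, -, -, -, -, h8⟩ := cfTail_period a h
    exact ⟨3, by rw [mul_add, mul_one, h8]; push_cast; ring⟩

lemma cfDigit_alpha0 (k : ℕ) :
    cfDigit alpha0 (8 * k + 1) = 1 ∧ cfDigit alpha0 (8 * k + 2) = 1 ∧
    cfDigit alpha0 (8 * k + 3) = 3 ∧ cfDigit alpha0 (8 * k + 4) = 1 ∧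
    cfDigit alpha0 (8 * k + 5) = 1 ∧ cfDigit alpha0 (8 * k + 6) = 1 ∧
    cfDigit alpha0 (8 * k + 7) = 1 ∧ cfDigit alpha0 (8 * k + 8) = 3 := by
  obtain ⟨hl, hu⟩ := sqrt_173_bounds
  obtain ⟨a, h⟩ := cfTail_alpha0_mul_eight k
  obtain ⟨h1, h2, h3, h4, h5, h6, h7, h8⟩ := cfTail_period a h
  simp only [cfDigit, h1, h2, h3, h4, h5, h6, h7, h8, Int.floor_eq_iff]
  unfold alpha0
  push_cast
  refine ⟨⟨?_, ?_⟩, ⟨?_, ?_⟩, ⟨?_, ?_⟩, ⟨?_, ?_⟩, ⟨?_, ?_⟩, ⟨?_, ?_⟩, ⟨?_, ?_⟩, ⟨?_, ?_⟩⟩ <;>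
    linarith

lemma cfDigit_alpha0_zero : cfDigit alpha0 0 = 2 := by
  obtain ⟨hl, hu⟩ := sqrt_173_bounds
  rw [cfDigit, cfTail, Int.floor_eq_iff, alpha0]
  push_cast
  constructor <;> linarith

lemma cfDigit_alpha0_add_eight (n : ℕ) :
    cfDigit alpha0 (n + 1 + 8) = cfDigit alpha0 (n + 1) := by
  obtain ⟨k, j, hj, rfl⟩ : ∃ k j, j < 8 ∧ n = 8 * k + j :=
    ⟨n / 8, n % 8, Nat.mod_lt _ (by norm_num), by omega⟩
  have h := cfDigit_alpha0 k
  have h' := cfDigit_alpha0 (k + 1)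
  simp only [mul_add, mul_one, add_assoc] at h h' ⊢
  interval_cases j <;> simp only [Nat.reduceAdd] at h h' ⊢ <;> simp [h, h']

/-- The first eight convergents of `α₀`. -/
lemma convergents_alpha0_initial :
    (cfNum alpha0 0 = 2 ∧ cfDen alpha0 0 = 1) ∧ (cfNum alpha0 1 = 3 ∧ cfDen alpha0 1 = 1) ∧
    (cfNum alpha0 2 = 5 ∧ cfDen alpha0 2 = 2) ∧ (cfNum alpha0 3 = 18 ∧ cfDen alpha0 3 = 7) ∧
    (cfNum alpha0 4 = 23 ∧ cfDen alpha0 4 = 9) ∧ (cfNum alpha0 5 = 41 ∧ cfDen alpha0 5 = 16) ∧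
    (cfNum alpha0 6 = 64 ∧ cfDen alpha0 6 = 25) ∧
    (cfNum alpha0 7 = 105 ∧ cfDen alpha0 7 = 41) := by
  have h := cfDigit_alpha0 0
  simp only [mul_zero, zero_add] at h
  simp [cfNum, cfDen, h, cfDigit_alpha0_zero]

/-- Shifting by a period acts on convergents as an automorph of `form0`. -/
lemma convergents_alpha0_add_eight (n : ℕ) :
    cfNum alpha0 (n + 8) = 105 * cfNum alpha0 n + 169 * cfDen alpha0 n ∧
    cfDen alpha0 (n + 8) = 41 * cfNum alpha0 n + 66 * cfDen alpha0 n := by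
  obtain ⟨⟨n0, d0⟩, ⟨n1, d1⟩, -, -, -, -, ⟨n6, d6⟩, n7, d7⟩ := convergents_alpha0_initial
  have h := cfDigit_alpha0 0
  have h' := cfDigit_alpha0 1
  simp only [mul_zero, zero_add, mul_one, Nat.reduceAdd] at h h'
  have n8 : cfNum alpha0 8 = 379 := by rw [cfNum, n6, n7]; simp [h]
  have d8 : cfDen alpha0 8 = 148 := by rw [cfDen, d6, d7]; simp [h]
  have n9 : cfNum alpha0 9 = 484 := by rw [cfNum, n8, n7]; simp [h']
  have d9 : cfDen alpha0 9 = 189 := by rw [cfDen, d8, d7]; simp [h']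
  induction n using Nat.twoStepInduction with
  | zero => simp [n8, d8, n0, d0]
  | one => simp [n9, d9, n1, d1]
  | more n ih₀ ih₁ =>
    have hd : cfDigit alpha0 (n + 8 + 2) = cfDigit alpha0 (n + 2) :=
      cfDigit_alpha0_add_eight (n + 1)
    have e : n + 1 + 8 = n + 8 + 1 := by omega
    rw [e] at ih₁
    rw [show n + 2 + 8 = n + 8 + 2 by omega]
    have hp : ∀ m, cfNum alpha0 (m + 2) =
        cfDigit alpha0 (m + 2) * cfNum alpha0 (m + 1) + cfNum alpha0 m := fun _ => rfl
    have hq : ∀ m, cfDen alpha0 (m + 2) =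
        cfDigit alpha0 (m + 2) * cfDen alpha0 (m + 1) + cfDen alpha0 m := fun _ => rfl
    rw [hp (n + 8), hq (n + 8), hp n, hq n, hd, ih₀.1, ih₀.2, ih₁.1, ih₁.2]
    constructor <;> ring

/-- Induction over convergents of `α₀` along periods. -/
lemma convergents_alpha0_induction {P : ℤ → ℤ → Prop} (h0 : P 2 1) (h1 : P 3 1) (h2 : P 5 2)
    (h3 : P 18 7) (h4 : P 23 9) (h5 : P 41 16) (h6 : P 64 25) (h7 : P 105 41)
    (hs : ∀ p q, P p q → P (105 * p + 169 * q) (41 * p + 66 * q)) (n : ℕ) :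
    P (cfNum alpha0 n) (cfDen alpha0 n) := by
  induction n using Nat.strong_induction_on with
  | _ n ih =>
    by_cases hn : n < 8
    · obtain ⟨⟨n0, d0⟩, ⟨n1, d1⟩, ⟨n2, d2⟩, ⟨n3, d3⟩, ⟨n4, d4⟩, ⟨n5, d5⟩, ⟨n6, d6⟩, n7, d7⟩ :=
        convergents_alpha0_initial
      interval_cases n <;> simp only [*]
    · obtain ⟨m, rfl⟩ := Nat.exists_eq_add_of_le' (not_lt.1 hn)
      obtain ⟨hp, hq⟩ := convergents_alpha0_add_eight m
      rw [hp, hq]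
      exact hs _ _ (ih m (by omega))

lemma form0_automorph (p q : ℤ) :
    form0 (105 * p + 169 * q) (41 * p + 66 * q) = form0 p q := by
  unfold form0; ring

lemma convergents_alpha0_pos (n : ℕ) : 1 ≤ cfNum alpha0 n ∧ 1 ≤ cfDen alpha0 n := by
  refine convergents_alpha0_induction (P := fun p q => 1 ≤ p ∧ 1 ≤ q) ?_ ?_ ?_ ?_ ?_ ?_ ?_ ?_ ?_ n
  all_goals omega

lemma abs_form0_convergents_alpha0_le (n : ℕ) :
    |form0 (cfNum alpha0 n) (cfDen alpha0 n)| ≤ 163 := by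
  refine convergents_alpha0_induction (P := fun p q => |form0 p q| ≤ 163)
    ?_ ?_ ?_ ?_ ?_ ?_ ?_ ?_ ?_ n
  case refine_9 => intro p q h; rwa [form0_automorph]
  all_goals decide

lemma succ_le_cfDen_alpha0 (n : ℕ) : (n : ℤ) + 1 ≤ 8 * cfDen alpha0 n := by
  induction n using Nat.strong_induction_on with
  | _ n ih =>
    by_cases hn : n < 8
    · have := (convergents_alpha0_pos n).2
      omega
    · obtain ⟨m, rfl⟩ := Nat.exists_eq_add_of_le' (not_lt.1 hn)
      have := convergents_alpha0_pos m
      have := (convergents_alpha0_add_eight m).2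
      have := ih m (by omega)
      push_cast
      omega

lemma form0_convergents_alpha0_seven (k : ℕ) :
    form0 (cfNum alpha0 (8 * k + 7)) (cfDen alpha0 (8 * k + 7)) = 41 := by
  induction k with
  | zero =>
    obtain ⟨-, -, -, -, -, -, -, n7, d7⟩ := convergents_alpha0_initial
    rw [mul_zero, zero_add, n7, d7]
    decide
  | succ k ih =>
    obtain ⟨hp, hq⟩ := convergents_alpha0_add_eight (8 * k + 7)
    rw [show 8 * (k + 1) + 7 = 8 * k + 7 + 8 by ring, hp, hq, form0_automorph, ih]

lemma convergents_alpha0_relations (k : ℕ) :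
    (cfDen alpha0 (8 * k + 1) = cfNum alpha0 (8 * k + 2) - 2 * cfDen alpha0 (8 * k + 2) ∧
      41 * cfNum alpha0 (8 * k + 1) =
        -43 * cfNum alpha0 (8 * k + 2) + 169 * cfDen alpha0 (8 * k + 2)) ∧
    (41 * cfDen alpha0 (8 * k + 6) =
        41 * cfNum alpha0 (8 * k + 7) - 80 * cfDen alpha0 (8 * k + 7) ∧
      41 * cfNum alpha0 (8 * k + 6) =
        -41 * cfNum alpha0 (8 * k + 7) + 169 * cfDen alpha0 (8 * k + 7)) := by
  induction k with
  | zero => simp [convergents_alpha0_initial]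
  | succ k ih =>
    have h1 := convergents_alpha0_add_eight (8 * k + 1)
    have h2 := convergents_alpha0_add_eight (8 * k + 2)
    have h6 := convergents_alpha0_add_eight (8 * k + 6)
    have h7 := convergents_alpha0_add_eight (8 * k + 7)
    simp only [show ∀ j, 8 * (k + 1) + j = 8 * k + j + 8 from fun j => by ring]
    omega

lemma small_form0_values : ∀ q ∈ List.range 82, ∀ p ∈ List.range 250,
    1 ≤ p ∧ 1 ≤ q ∧ |form0 p q| ≤ 163 →
    (p, q) ∈ [(2, 1), (3, 1), (5, 2), (18, 7), (23, 9), (41, 16), (64, 25), (105, 41)] := by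
  decide +kernel

lemma eq_convergent_of_small {p q : ℤ} (hp : 1 ≤ p) (hq : 1 ≤ q) (hq' : q < 82)
    (h : |form0 p q| ≤ 163) : ∃ n, (p, q) = (cfNum alpha0 n, cfDen alpha0 n) := by
  have hp' : p < 250 := by
    by_contra! hp'
    have := (abs_le.1 h).2
    unfold form0 at this
    nlinarith
  lift p to ℕ using by omega
  lift q to ℕ using by omega
  have hmem := small_form0_values q (List.mem_range.2 (by omega)) p
    (List.mem_range.2 (by omega)) ⟨by omega, by omega, h⟩
  simp only [List.mem_cons, Prod.mk.injEq, List.not_mem_nil, or_false] at hmem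
  obtain ⟨⟨n0, d0⟩, ⟨n1, d1⟩, ⟨n2, d2⟩, ⟨n3, d3⟩, ⟨n4, d4⟩, ⟨n5, d5⟩, ⟨n6, d6⟩, n7, d7⟩ :=
    convergents_alpha0_initial
  rcases hmem with ⟨rfl, rfl⟩ | ⟨rfl, rfl⟩ | ⟨rfl, rfl⟩ | ⟨rfl, rfl⟩ | ⟨rfl, rfl⟩ | ⟨rfl, rfl⟩ |
    ⟨rfl, rfl⟩ | ⟨rfl, rfl⟩
  exacts [⟨0, by simp [n0, d0]⟩, ⟨1, by simp [n1, d1]⟩, ⟨2, by simp [n2, d2]⟩,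
    ⟨3, by simp [n3, d3]⟩, ⟨4, by simp [n4, d4]⟩, ⟨5, by simp [n5, d5]⟩, ⟨6, by simp [n6, d6]⟩,
    ⟨7, by simp [n7, d7]⟩]

/-- Small values of `form0` at positive arguments come from convergents of `α₀`. -/
lemma eq_convergent_of_abs_form0_le {p q : ℤ} (hp : 1 ≤ p) (hq : 1 ≤ q)
    (h : |form0 p q| ≤ 163) : ∃ n, (p, q) = (cfNum alpha0 n, cfDen alpha0 n) := by
  induction hN : q.toNat using Nat.strong_induction_on generalizing p q with
  | _ N ih =>
    by_cases hq' : q < 82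
    · exact eq_convergent_of_small hp hq hq' h
    · push Not at hq'
      have hF := abs_le.1 h
      have hlow : 41 * p < 105 * q := by
        by_contra! hc
        have := hF.2
        unfold form0 at this
        nlinarith [mul_nonneg (sub_nonneg.2 hc) (by linarith : (0 : ℤ) ≤ 41 * p + 66 * q)]
      have hup : 169 * q < 66 * p := by
        by_contra! hc
        have := hF.1
        unfold form0 at this
        nlinarith [mul_nonneg (sub_nonneg.2 hc) (by linarith : (0 : ℤ) ≤ 41 * p + 66 * q)]
      have hF' : form0 (66 * p - 169 * q) (-41 * p + 105 * q) = form0 p q := by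
        unfold form0; ring
      obtain ⟨n, hn⟩ := ih (-41 * p + 105 * q).toNat (by omega) (p := 66 * p - 169 * q)
        (q := -41 * p + 105 * q) (by omega) (by omega) (by rwa [hF']) rfl
      obtain ⟨h1, h2⟩ := Prod.mk.inj hn
      obtain ⟨h3, h4⟩ := convergents_alpha0_add_eight n
      exact ⟨n + 8, Prod.ext (by simp only; omega) (by simp only; omega)⟩

lemma form0_eq (p q : ℤ) :
    (form0 p q : ℝ) =
      (p - q * alpha0) * (41 * (p - q * alpha0) + q * (13 * Real.sqrt 173)) := by
  unfold form0 alpha0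
  push_cast
  linear_combination (169 / 164 * q ^ 2 : ℝ) * sq_sqrt_173

/-- Lower bound for the error of a rational approximation which is not a convergent. -/
lemma le_abs_of_not_convergent {p q : ℤ} {t : ℝ} (hq : 1 ≤ q) (hqt : (q : ℝ) ≤ t)
    (h : ∀ n : ℕ, (p, q) ≠ (cfNum alpha0 n, cfDen alpha0 n)) :
    164 / (t * (13 * Real.sqrt 173) + 41) ≤ |(q : ℝ) * alpha0 - p| := by
  obtain ⟨hl, hu⟩ := sqrt_173_bounds
  have hq1 : (1 : ℝ) ≤ q := by exact_mod_cast hq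
  have hD : (170 : ℝ) ≤ 13 * Real.sqrt 173 := by linarith
  rw [abs_sub_comm, div_le_iff₀ (by nlinarith)]
  by_cases hδ : |(p : ℝ) - q * alpha0| ≤ 1
  · have hα : (2 : ℝ) ≤ alpha0 := by unfold alpha0; linarith
    have hp : 1 ≤ p := by
      have : (1 : ℝ) ≤ p := by nlinarith [(abs_le.1 hδ).1]
      exact_mod_cast this
    have hF : (164 : ℝ) ≤ |(form0 p q : ℝ)| := by
      have : 164 ≤ |form0 p q| := by
        by_contra! hc
        obtain ⟨n, hn⟩ := eq_convergent_of_abs_form0_le hp hq (by omega)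
        exact h n hn
      exact_mod_cast this
    rw [form0_eq, abs_mul] at hF
    refine hF.trans (mul_le_mul_of_nonneg_left ?_ (abs_nonneg _))
    have hδ' := abs_le.1 hδ
    rw [abs_le]
    constructor <;> nlinarith
  · push Not at hδ
    have : 164 ≤ t * (13 * Real.sqrt 173) + 41 := by nlinarith
    nlinarith

lemma bddBelow_psi2_set (α t : ℝ) :
    BddBelow { x : ℝ | ∃ p q : ℤ, 1 ≤ q ∧ (q : ℝ) ≤ t ∧
      (∀ n : ℕ, (p, q) ≠ (cfNum α n, cfDen α n)) ∧ x = |(q : ℝ) * α - (p : ℝ)| } :=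
  ⟨0, by rintro x ⟨p, q, -, -, -, rfl⟩; exact abs_nonneg _⟩

lemma le_mul_psi2 {t : ℝ} (ht : 1 ≤ t) :
    t * (164 / (t * (13 * Real.sqrt 173) + 41)) ≤ t * psi2 alpha0 t := by
  refine mul_le_mul_of_nonneg_left (le_csInf ?_ ?_) (by linarith)
  · refine ⟨_, 100, 1, le_rfl, by simpa using ht, fun n hn => ?_, rfl⟩
    obtain ⟨h1, h2⟩ := Prod.mk.inj hn
    have := abs_form0_convergents_alpha0_le n
    rw [← h1, ← h2] at this
    revert this
    decide
  · rintro x ⟨p, q, hq, hqt, h, rfl⟩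
    exact le_abs_of_not_convergent hq hqt h

lemma mul_psi2_le (k : ℕ) :
    ((2 * cfDen alpha0 (8 * k + 7) : ℤ) : ℝ) *
      psi2 alpha0 ((2 * cfDen alpha0 (8 * k + 7) : ℤ) : ℝ) ≤ 164 / (13 * Real.sqrt 173) := by
  obtain ⟨hl, hu⟩ := sqrt_173_bounds
  have hF := form0_convergents_alpha0_seven k
  obtain ⟨hp, hq⟩ := convergents_alpha0_pos (8 * k + 7)
  set p := cfNum alpha0 (8 * k + 7)
  set q := cfDen alpha0 (8 * k + 7)
  have hq1 : (1 : ℝ) ≤ q := by exact_mod_cast hq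
  have hp1 : (1 : ℝ) ≤ p := by exact_mod_cast hp
  have hnot : ∀ n : ℕ, (2 * p, 2 * q) ≠ (cfNum alpha0 n, cfDen alpha0 n) := by
    intro n hn
    obtain ⟨h1, h2⟩ := Prod.mk.inj hn
    have := (abs_le.1 (abs_form0_convergents_alpha0_le n)).2
    rw [← h1, ← h2] at this
    unfold form0 at this hF
    linarith
  have hψ : psi2 alpha0 ((2 * q : ℤ) : ℝ) ≤ |((2 * q : ℤ) : ℝ) * alpha0 - (2 * p : ℤ)| :=
    csInf_le (bddBelow_psi2_set _ _) ⟨2 * p, 2 * q, by omega, le_rfl, hnot, rfl⟩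
  have hF' := form0_eq p q
  rw [hF] at hF'
  push_cast at hF' hψ ⊢
  have hpos : 0 < 41 * ((p : ℝ) - q * alpha0) + q * (13 * Real.sqrt 173) := by
    unfold alpha0; nlinarith
  have hδ : 0 < (p : ℝ) - q * alpha0 := by
    by_contra! hc
    nlinarith
  have habs : |2 * (q : ℝ) * alpha0 - 2 * p| = 2 * ((p : ℝ) - q * alpha0) := by
    rw [abs_sub_comm, abs_of_pos (by linarith)]; ring
  rw [habs] at hψ
  rw [le_div_iff₀ (by linarith)]
  have h2 : 2 * (q : ℝ) * psi2 alpha0 (2 * q) ≤ 2 * q * (2 * ((p : ℝ) - q * alpha0)) :=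
    mul_le_mul_of_nonneg_left hψ (by linarith)
  calc _ ≤ 2 * q * (2 * ((p : ℝ) - q * alpha0)) * (13 * Real.sqrt 173) :=
        mul_le_mul_of_nonneg_right h2 (by linarith)
    _ ≤ 164 := by nlinarith [sq_nonneg ((p : ℝ) - q * alpha0)]

lemma kConst_alpha0 : kConst alpha0 = 164 / (13 * Real.sqrt 173) := by
  have hs := sqrt_173_bounds.1
  have hfreq : ∃ᶠ t : ℝ in atTop, t * psi2 alpha0 t ≤ 164 / (13 * Real.sqrt 173) := by
    rw [frequently_atTop]
    intro T
    obtain ⟨k, hk⟩ := exists_nat_ge T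
    refine ⟨_, hk.trans ?_, mul_psi2_le k⟩
    have := succ_le_cfDen_alpha0 (8 * k + 7)
    have : (k : ℤ) ≤ 2 * cfDen alpha0 (8 * k + 7) := by push_cast at this; omega
    exact_mod_cast this
  have hlim : Tendsto (fun t : ℝ => t * (164 / (t * (13 * Real.sqrt 173) + 41))) atTop
      (nhds (164 / (13 * Real.sqrt 173))) := by
    have h1 : Tendsto (fun t : ℝ => 164 / (13 * Real.sqrt 173 + 41 * t⁻¹)) atTop
        (nhds (164 / (13 * Real.sqrt 173 + 41 * 0))) :=
      tendsto_const_nhds.div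
        (tendsto_const_nhds.add (tendsto_inv_atTop_zero.const_mul _)) (by positivity)
    rw [mul_zero, add_zero] at h1
    refine h1.congr' ?_
    filter_upwards [eventually_ge_atTop 1] with t ht
    have : (0 : ℝ) < t := by linarith
    have : 0 < t * (13 * Real.sqrt 173) + 41 := by positivity
    field_simp
  have hev : ∀ᶠ t : ℝ in atTop,
      t * (164 / (t * (13 * Real.sqrt 173) + 41)) ≤ t * psi2 alpha0 t := by
    filter_upwards [eventually_ge_atTop 1] with t ht using le_mul_psi2 ht
  refine le_antisymm (liminf_le_of_frequently_le hfreq ?_) ?_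
  · exact hlim.isBoundedUnder_ge.mono_ge hev
  · rw [← hlim.liminf_eq]
    exact liminf_le_liminf hev hlim.isBoundedUnder_ge (IsCoboundedUnder.of_frequently_le hfreq)

lemma tendsto_convergents_alpha0 :
    Tendsto (fun n => (cfNum alpha0 n : ℝ) / cfDen alpha0 n) atTop (nhds alpha0) := by
  have hs := sqrt_173_bounds
  have h0 : Tendsto (fun n : ℕ => 32 * (1 / ((n : ℝ) + 1))) atTop (nhds 0) := by
    simpa using tendsto_one_div_add_atTop_nhds_zero_nat.const_mul (32 : ℝ)
  rw [tendsto_iff_dist_tendsto_zero]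
  refine squeeze_zero (fun _ => dist_nonneg) (fun n => ?_) h0
  obtain ⟨hp, hq⟩ := convergents_alpha0_pos n
  have hF : |(form0 (cfNum alpha0 n) (cfDen alpha0 n) : ℝ)| ≤ 163 := by
    exact_mod_cast abs_form0_convergents_alpha0_le n
  have hn : (n : ℝ) + 1 ≤ 8 * cfDen alpha0 n := by exact_mod_cast succ_le_cfDen_alpha0 n
  rw [form0_eq, abs_mul] at hF
  set p := cfNum alpha0 n
  set q := cfDen alpha0 n
  have hq1 : (1 : ℝ) ≤ q := by exact_mod_cast hq
  have hp1 : (1 : ℝ) ≤ p := by exact_mod_cast hp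
  have hge : 41 ≤ |41 * ((p : ℝ) - q * alpha0) + q * (13 * Real.sqrt 173)| := by
    refine le_trans ?_ (le_abs_self _)
    unfold alpha0; nlinarith
  have hδ : |(p : ℝ) - q * alpha0| ≤ 4 := by
    nlinarith [abs_nonneg ((p : ℝ) - q * alpha0)]
  have hq0 : (0 : ℝ) < q := by linarith
  rw [Real.dist_eq, show (p : ℝ) / q - alpha0 = (p - q * alpha0) / q by field_simp, abs_div,
    abs_of_pos hq0, mul_one_div, div_le_div_iff₀ hq0 (by positivity)]
  nlinarith [abs_nonneg ((p : ℝ) - q * alpha0)]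

lemma kappa4_alpha0 {n : ℕ} (hn : 1 ≤ n) (hd : 2 ≤ cfDigit alpha0 n) :
    kappa4 alpha0 n =
      4 / (alpha0 + (cfNum alpha0 (n - 1) : ℝ) / cfDen alpha0 (n - 1) - 39 / 41) := by
  have hne : ∀ m, cfDen alpha0 m ≠ 0 := fun m => by
    have := (convergents_alpha0_pos m).2
    omega
  obtain ⟨k, j, hj, rfl⟩ : ∃ k j, j < 8 ∧ n = 8 * k + j + 1 :=
    ⟨(n - 1) / 8, (n - 1) % 8, Nat.mod_lt _ (by norm_num), by omega⟩
  obtain ⟨a, h⟩ := cfTail_alpha0_mul_eight k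
  obtain ⟨-, -, h3, -, -, -, -, h8⟩ := cfTail_period a h
  obtain ⟨⟨r2, -⟩, r7, -⟩ := convergents_alpha0_relations k
  have hdig := cfDigit_alpha0 k
  have hj' : j = 2 ∨ j = 7 := by
    by_contra! hc
    interval_cases j <;> simp_all
  rw [kappa4, Nat.add_sub_cancel]
  congr 1
  rcases hj' with rfl | rfl
  · have hc : (cfDen alpha0 (8 * k + 2) : ℝ) ≠ 0 := by exact_mod_cast hne _
    have h3' : (125 + 13 * Real.sqrt 173) / 82 = alpha0 + 43 / 41 := by unfold alpha0; ring
    rw [h3, h3', cfStar_succ_eq_div _ hne (8 * k + 1), r2]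
    push_cast
    field_simp
    ring
  · have hc : (cfDen alpha0 (8 * k + 7) : ℝ) ≠ 0 := by exact_mod_cast hne _
    have r : (cfDen alpha0 (8 * k + 6) : ℝ) =
        cfNum alpha0 (8 * k + 7) - 80 / 41 * cfDen alpha0 (8 * k + 7) := by
      have : (41 * cfDen alpha0 (8 * k + 6) : ℝ) =
        41 * cfNum alpha0 (8 * k + 7) - 80 * cfDen alpha0 (8 * k + 7) := by exact_mod_cast r7
      linarith
    rw [h8, cfStar_succ_eq_div _ hne (8 * k + 6), r]
    field_simp
    ring

lemma liminf_kappa4_alpha0 :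
    liminf (fun n : ℕ => kappa4 alpha0 n) (atTop ⊓ 𝓟 {n : ℕ | 2 ≤ cfDigit alpha0 n}) =
      164 / (13 * Real.sqrt 173) := by
  have hs := sqrt_173_bounds.1
  have hlim : Tendsto (fun n : ℕ =>
      4 / (alpha0 + (cfNum alpha0 (n - 1) : ℝ) / cfDen alpha0 (n - 1) - 39 / 41)) atTop
      (nhds (164 / (13 * Real.sqrt 173))) := by
    have hval : 164 / (13 * Real.sqrt 173) = 4 / (alpha0 + alpha0 - 39 / 41) := by
      rw [show alpha0 + alpha0 - 39 / 41 = 13 * Real.sqrt 173 / 41 by unfold alpha0; ring]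
      field_simp
      norm_num
    rw [hval]
    refine tendsto_const_nhds.div ((tendsto_const_nhds.add
      (tendsto_convergents_alpha0.comp (tendsto_sub_atTop_nat 1))).sub_const _) ?_
    unfold alpha0
    intro h
    linarith
  have : (atTop ⊓ 𝓟 {n : ℕ | 2 ≤ cfDigit alpha0 n}).NeBot := by
    rw [← frequently_mem_iff_neBot, frequently_atTop]
    intro N
    obtain ⟨-, -, h3, -⟩ := cfDigit_alpha0 N
    exact ⟨8 * N + 3, by omega, by simp [h3]⟩
  refine Tendsto.liminf_eq ((hlim.mono_left inf_le_left).congr' ?_)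
  rw [EventuallyEq, eventually_inf_principal]
  filter_upwards [eventually_ge_atTop 1] with n hn hd using (kappa4_alpha0 hn hd).symm

/-- For `α₀ = (13√173 + 39)/82` one has
`𝔨(α₀) = liminf_{n → ∞, aₙ ≥ 2} κ⁴ₙ(α₀) = 164/(13√173)`. -/
theorem stmt_8 :
    kConst ((13 * Real.sqrt 173 + 39) / 82) =
      liminf (fun n : ℕ => kappa4 ((13 * Real.sqrt 173 + 39) / 82) n)
        (atTop ⊓ 𝓟 {n : ℕ | 2 ≤ cfDigit ((13 * Real.sqrt 173 + 39) / 82) n}) ∧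
    kConst ((13 * Real.sqrt 173 + 39) / 82) = 164 / (13 * Real.sqrt 173) := by
  exact ⟨kConst_alpha0.trans liminf_kappa4_alpha0.symm, kConst_alpha0⟩
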